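/- arXiv:1501.03028 — 2 statements merged into one kernel-verified Lean document; each statement's English description precedes it below -/
import Mathlib

section
/- Triple disjunction lemma: For any signature Σ = (V,E,{P_e}), if edge g is a gateway between sets of edges A ⊆ E and B ⊆ E, φ ∈ Φ(Σ,{g}), ψ ∈ Φ(Σ,A), and χ ∈ Φ(Σ,B), then ⊢ □_g(φ∨ψ∨χ) → (φ ∨ □_gψ ∨ □_gχ) (where φ∨ψ abbreviates ¬φ→ψ and ¬φ abbreviates φ→⊥). -/
/- Formulas of the language Φ(Σ): atoms are indexed by a type `P` of
propositional symbols; `edgeOf p` is the unique edge `e` with `p ∈ P_e`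
(this encodes a pairwise disjoint family `{P_e}_{e ∈ E}`). -/
inductive Form (E P : Type) : Type
  | bot : Form E P
  | atom : P → Form E P
  | imp : Form E P → Form E P → Form E P
  | box : E → Form E P → Form E P

namespace Form
/-- ¬φ abbreviates φ → ⊥. -/
def neg {E P : Type} (φ : Form E P) : Form E P := imp φ bot
/-- φ ∨ ψ abbreviates ¬φ → ψ. -/
def or {E P : Type} (φ ψ : Form E P) : Form E P := imp (neg φ) ψ
end Form

/-- An undirected multigraph is given by `inc : E → V × V` sending each edge to
its (two, possibly equal) ends.  `Incident inc e v` says `v` is an end of `e`. -/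
def Incident {V E : Type} (inc : E → V × V) (e : E) (v : V) : Prop :=
  (inc e).1 = v ∨ (inc e).2 = v

/-- Adjacency using only edges from the set `S`. -/
def AdjVia {V E : Type} (inc : E → V × V) (S : Set E) (u v : V) : Prop :=
  ∃ e ∈ S, inc e = (u, v) ∨ inc e = (v, u)

/-- Reachability using only edges from the set `S`. -/
def ReachableVia {V E : Type} (inc : E → V × V) (S : Set E) : V → V → Prop :=
  Relation.ReflTransGen (AdjVia inc S)

/-- The graph is connected. -/
def ConnectedGraph {V E : Type} (inc : E → V × V) : Prop :=
  ∀ u v : V, ReachableVia inc Set.univ u v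

/-- A path `e₀, v₁, e₁, …, v_k, e_k`: distinct edges, distinct vertices, with
`e_i, e_{i+1}` incident to `v_{i+1}` for `0 ≤ i < k`. -/
structure GPath (V E : Type) (inc : E → V × V) where
  edges : List E
  verts : List V
  len_eq : edges.length = verts.length + 1
  edges_nodup : edges.Nodup
  verts_nodup : verts.Nodup
  incid_left : ∀ i (hi : i < verts.length),
    Incident inc (edges.get ⟨i, by omega⟩) (verts.get ⟨i, hi⟩)
  incid_right : ∀ i (hi : i < verts.length),
    Incident inc (edges.get ⟨i + 1, by omega⟩) (verts.get ⟨i, hi⟩)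

/-- `g` is a gateway between `A` and `B`: every path that starts with an edge
in `A` and ends with an edge in `B` contains the edge `g`. -/
def IsGateway {V E : Type} (inc : E → V × V) (A B : Set E) (g : E) : Prop :=
  ∀ p : GPath V E inc, ∀ hne : p.edges ≠ [],
    p.edges.head hne ∈ A → p.edges.getLast hne ∈ B → g ∈ p.edges

/-- The sublanguage Φ(Σ,T). -/
inductive InLang {E P : Type} (edgeOf : P → E) (T : Set E) : Form E P → Prop
  | bot : InLang edgeOf T Form.bot
  | atom (p : P) : edgeOf p ∈ T → InLang edgeOf T (Form.atom p)
  | imp {φ ψ : Form E P} : InLang edgeOf T φ → InLang edgeOf T ψ →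
      InLang edgeOf T (Form.imp φ ψ)
  | box (t : E) (φ : Form E P) : t ∈ T → InLang edgeOf T (Form.box t φ)

/-- Evaluation of a formula under a truth assignment `v` that treats atoms and
boxed formulas as atomic. -/
def evalWith {E P : Type} (v : Form E P → Prop) : Form E P → Prop
  | Form.bot => False
  | Form.imp φ ψ => evalWith v φ → evalWith v ψ
  | φ => v φ

/-- Propositional tautology. -/
def Tautology {E P : Type} (φ : Form E P) : Prop := ∀ v, evalWith v φ

/-- The proof system: propositional tautologies, Truth, Positive Introspection,
Negative Introspection, Distributivity, Gateway; Modus Ponens, Necessitation. -/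
inductive Deriv {V E P : Type} (inc : E → V × V) (edgeOf : P → E) : Form E P → Prop
  | taut {φ : Form E P} : Tautology φ → Deriv inc edgeOf φ
  | truth (e : E) (φ : Form E P) : Deriv inc edgeOf (Form.imp (Form.box e φ) φ)
  | posIntro (e : E) (φ : Form E P) :
      Deriv inc edgeOf (Form.imp (Form.box e φ) (Form.box e (Form.box e φ)))
  | negIntro (e : E) (φ : Form E P) :
      Deriv inc edgeOf (Form.imp (Form.neg (Form.box e φ)) (Form.box e (Form.neg (Form.box e φ))))
  | distrib (e : E) (φ ψ : Form E P) :
      Deriv inc edgeOf (Form.imp (Form.box e (Form.imp φ ψ))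
        (Form.imp (Form.box e φ) (Form.box e ψ)))
  | gateway {A B : Set E} {g e : E} {φ ψ : Form E P} :
      IsGateway inc A B g → e ∈ A → InLang edgeOf A φ → InLang edgeOf B ψ →
      Deriv inc edgeOf (Form.imp (Form.box e (Form.imp φ ψ)) (Form.imp φ (Form.box g ψ)))
  | mp {φ ψ : Form E P} : Deriv inc edgeOf (Form.imp φ ψ) → Deriv inc edgeOf φ →
      Deriv inc edgeOf ψ
  | nec (e : E) {φ : Form E P} : Deriv inc edgeOf φ → Deriv inc edgeOf (Form.box e φ)

/-- `X ⊢ φ`: derivable from assumptions `X` using theorems of the system and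
Modus Ponens only. -/
inductive DerivFrom {V E P : Type} (inc : E → V × V) (edgeOf : P → E)
    (X : Set (Form E P)) : Form E P → Prop
  | ax {φ : Form E P} : Deriv inc edgeOf φ → DerivFrom inc edgeOf X φ
  | hyp {φ : Form E P} : φ ∈ X → DerivFrom inc edgeOf X φ
  | mp {φ ψ : Form E P} : DerivFrom inc edgeOf X (Form.imp φ ψ) →
      DerivFrom inc edgeOf X φ → DerivFrom inc edgeOf X ψ

/-- A protocol over the signature: a set of values `W e` for each channel `e`,
local conditions `L v` at each vertex, and a valuation `π`. -/
structure Protocol {V E P : Type} (inc : E → V × V) (edgeOf : P → E) where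
  W : E → Type
  L : (v : V) → Set ((e : {e : E // Incident inc e v}) → W e.1)
  pi : (p : P) → Set (W (edgeOf p))

/-- A run of a protocol. -/
def IsRun {V E P : Type} {inc : E → V × V} {edgeOf : P → E}
    (Pr : Protocol inc edgeOf) (r : (e : E) → Pr.W e) : Prop :=
  ∀ v : V, (fun e : {e : E // Incident inc e v} => r e.1) ∈ Pr.L v

def Run {V E P : Type} {inc : E → V × V} {edgeOf : P → E}
    (Pr : Protocol inc edgeOf) : Type :=
  {r : (e : E) → Pr.W e // IsRun Pr r}

/-- Satisfaction `r ⊩ φ`. -/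
def Sat {V E P : Type} {inc : E → V × V} {edgeOf : P → E}
    (Pr : Protocol inc edgeOf) : Run Pr → Form E P → Prop
  | _, Form.bot => False
  | r, Form.atom p => r.1 (edgeOf p) ∈ Pr.pi p
  | r, Form.imp φ ψ => Sat Pr r φ → Sat Pr r ψ
  | r, Form.box e φ => ∀ r' : Run Pr, r'.1 e = r.1 e → Sat Pr r' φ

namespace Deriv

variable {V E P : Type} {inc : E → V × V} {edgeOf : P → E}

/-- Chaining of derivable implications. -/
theorem trans {φ ψ χ : Form E P} (h₁ : Deriv inc edgeOf (.imp φ ψ))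
    (h₂ : Deriv inc edgeOf (.imp ψ χ)) : Deriv inc edgeOf (.imp φ χ) := by
  refine .mp (.mp (.taut fun v => ?_) h₁) h₂
  simp only [evalWith]
  tauto

/-- Modal necessity is monotone. -/
theorem box_mono (e : E) {φ ψ : Form E P} (h : Deriv inc edgeOf (.imp φ ψ)) :
    Deriv inc edgeOf (.imp (.box e φ) (.box e ψ)) :=
  .mp (.distrib e φ ψ) (.nec e h)

/-- A formula in the language of the single edge `g` is known at `g` whenever it holds. -/
theorem imp_box_of_inLang_singleton {g : E} {φ : Form E P} (hφ : InLang edgeOf {g} φ) :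
    Deriv inc edgeOf (.imp φ (.box g φ)) := by
  have hg : IsGateway inc {g} {g} g := fun p hne hhead _ => by
    have h := List.head_mem hne
    rwa [Set.mem_singleton_iff.mp hhead] at h
  refine .mp (.gateway hg (Set.mem_singleton g) hφ hφ) (.nec g (.taut fun v => ?_))
  simp only [evalWith]
  exact id

end Deriv

/-- A gateway edge may be added to the source set. -/
theorem IsGateway.insert_left {V E : Type} {inc : E → V × V} {A B : Set E} {g : E}
    (hg : IsGateway inc A B g) : IsGateway inc (insert g A) B g := by
  intro p hne hhead hlast
  rcases Set.mem_insert_iff.mp hhead with h | h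
  · have hmem := List.head_mem hne
    rwa [h] at hmem
  · exact hg p hne h hlast

theorem InLang.mono {E P : Type} {edgeOf : P → E} {S T : Set E} (hST : S ⊆ T) {φ : Form E P}
    (h : InLang edgeOf S φ) : InLang edgeOf T φ := by
  induction h with
  | bot => exact .bot
  | atom p hp => exact .atom p (hST hp)
  | imp _ _ ih₁ ih₂ => exact .imp ih₁ ih₂
  | box t φ ht => exact .box t φ (hST ht)

/-- Knowledge at a gateway distributes over a disjunction of formulas about its two sides. -/
theorem Deriv.box_or_of_isGateway {V E P : Type} {inc : E → V × V} {edgeOf : P → E}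
    {A B : Set E} {g : E} (hg : IsGateway inc A B g) {ψ χ : Form E P}
    (hψ : InLang edgeOf A ψ) (hχ : InLang edgeOf B χ) :
    Deriv inc edgeOf (.imp (.box g (.or ψ χ)) (.or (.box g ψ) (.box g χ))) := by
  have hright : Deriv inc edgeOf (.imp (.box g (.or ψ χ)) (.imp ψ.neg (.box g χ))) :=
    .gateway hg.insert_left (Set.mem_insert g A)
      (.imp (hψ.mono (Set.subset_insert g A)) .bot) hχ
  have hswap : Deriv inc edgeOf
      (.imp (.box g (.or ψ χ)) (.imp (.neg (.box g χ)) ψ)) := by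
    refine hright.trans (.taut fun v => ?_)
    simp only [evalWith, Form.neg]
    tauto
  have hleft : Deriv inc edgeOf
      (.imp (.box g (.or ψ χ)) (.imp (.box g (.neg (.box g χ))) (.box g ψ))) :=
    (Deriv.posIntro g _).trans ((hswap.box_mono g).trans (.distrib g _ _))
  refine .mp (.mp (.taut fun v => ?_) hleft) (.negIntro g χ)
  simp only [evalWith, Form.neg, Form.or]
  tauto

/-- Triple disjunction lemma: if g is a gateway between A and B,
φ ∈ Φ(Σ,{g}), ψ ∈ Φ(Σ,A), χ ∈ Φ(Σ,B), then ⊢ □_g(φ∨ψ∨χ) → (φ ∨ □_gψ ∨ □_gχ). -/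
theorem triple_disj {V E P : Type} (inc : E → V × V) (edgeOf : P → E)
    (hconn : ConnectedGraph inc)
    (A B : Set E) (g : E) (hg : IsGateway inc A B g)
    (φ ψ χ : Form E P)
    (hφ : InLang edgeOf {g} φ) (hψ : InLang edgeOf A ψ) (hχ : InLang edgeOf B χ) :
    Deriv inc edgeOf (Form.imp
      (Form.box g (Form.or φ (Form.or ψ χ)))
      (Form.or φ (Form.or (Form.box g ψ) (Form.box g χ)))) := by
  have hneg : Deriv inc edgeOf (.imp φ.neg (.box g φ.neg)) :=
    .imp_box_of_inLang_singleton (.imp hφ .bot)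
  refine .mp (.mp (.mp (.taut fun v => ?_) hneg)
    (.distrib g φ.neg (.or ψ χ))) (Deriv.box_or_of_isGateway hg hψ hχ)
  simp only [evalWith, Form.neg, Form.or]
  tauto
end

section
/- Path-existence lemma: For any signature Σ = (V,E,{P_e}), any δ = ⋁_{e∈E} δ_e ∈ Δ(Σ), any maximal consistent set of formulas M ⊆ Φ(Σ), and any edge e ∈ E, if □_eδ ∈ M and δ_e ∉ M, then there is a path in the set Γ_M that starts with the edge e. -/
/-- Big disjunction of a list of formulas. -/
def bigDisj {E P : Type} : List (Form E P) → Form E P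
  | [] => Form.bot
  | φ :: l => Form.or φ (bigDisj l)

/-- The disjunction ⋁_{e ∈ s} δ_e. -/
noncomputable def disjOver {E P : Type} (s : Finset E) (d : E → Form E P) : Form E P :=
  bigDisj (s.toList.map d)

/-- The formula δ = ⋁_{e ∈ E} δ_e. -/
noncomputable def deltaForm {E P : Type} [Fintype E] (d : E → Form E P) : Form E P :=
  disjOver Finset.univ d

/-- ⋁_{h ∈ S} δ_h for a set of edges `S`. -/
noncomputable def disjSet {E P : Type} [Fintype E] (d : E → Form E P) (S : Set E) : Form E P :=
  disjOver (Set.toFinite S).toFinset d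

/-- `e` is a bridge: removing it disconnects the graph. -/
def IsBridge {V E : Type} (inc : E → V × V) (e : E) : Prop :=
  ¬ ∀ u v : V, ReachableVia inc {x | x ≠ e} u v

/-- Edges of the connected component `C^u_{-e}` of the graph with `e` deleted
that contains the vertex `u`. -/
def compEdges {V E : Type} (inc : E → V × V) (e : E) (u : V) : Set E :=
  {h | h ≠ e ∧ ∃ w : V, Incident inc h w ∧ ReachableVia inc {x | x ≠ e} u w}

/-- `X` is consistent. -/
def ConsistentSet {V E P : Type} (inc : E → V × V) (edgeOf : P → E)
    (X : Set (Form E P)) : Prop :=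
  ¬ DerivFrom inc edgeOf X Form.bot

/-- `X` is a maximal consistent subset of Φ(Σ,T). -/
def MaxConsistentIn {V E P : Type} (inc : E → V × V) (edgeOf : P → E)
    (T : Set E) (X : Set (Form E P)) : Prop :=
  (∀ φ ∈ X, InLang edgeOf T φ) ∧ ConsistentSet inc edgeOf X ∧
    ∀ φ : Form E P, InLang edgeOf T φ → φ ∉ X →
      ¬ ConsistentSet inc edgeOf (insert φ X)

/-- `X` is a maximal consistent subset of Φ(Σ). -/
def MaxConsistent {V E P : Type} (inc : E → V × V) (edgeOf : P → E)
    (X : Set (Form E P)) : Prop :=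
  ConsistentSet inc edgeOf X ∧
    ∀ φ : Form E P, φ ∉ X → ¬ ConsistentSet inc edgeOf (insert φ X)

/-- A value of an edge under a canonical protocol 𝒫^δ_F: a set of formulas `X`
together with flow values `f₁`, `f₂` at the two ends `(inc e).1`, `(inc e).2`. -/
structure CanValue (E P : Type) where
  X : Set (Form E P)
  f₁ : ℝ
  f₂ : ℝ

/-- The defining conditions on a value of edge `e` under the canonical
protocol 𝒫^δ_F, where δ = ⋁_{e ∈ E} d e. -/
def IsCanValue {V E P : Type} [Fintype E] (inc : E → V × V) (edgeOf : P → E)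
    (d : E → Form E P) (F : Set E) (e : E) (w : CanValue E P) : Prop :=
  MaxConsistentIn inc edgeOf {e} w.X ∧
  (w.f₁ + w.f₂ > 0 ↔ d e ∈ w.X) ∧
  (IsBridge inc e → d e ∉ w.X → w.f₁ + w.f₂ = 0) ∧
  (IsBridge inc e → w.f₁ < 0 →
    Form.box e (disjSet d (compEdges inc e (inc e).1)) ∈ w.X) ∧
  (IsBridge inc e → w.f₂ < 0 →
    Form.box e (disjSet d (compEdges inc e (inc e).2)) ∈ w.X) ∧
  (IsBridge inc e → e ∈ F → Form.box e (deltaForm d) ∈ w.X → d e ∉ w.X →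
    w.f₁ < 0 ∨ w.f₂ < 0) ∧
  (¬ IsBridge inc e → w.f₁ + w.f₂ < 0 → Form.box e (deltaForm d) ∈ w.X) ∧
  (¬ IsBridge inc e → e ∈ F → Form.box e (deltaForm d) ∈ w.X → d e ∉ w.X →
    w.f₁ + w.f₂ < 0)

open Classical in
/-- The flow value `f^e_u` of edge `e` at vertex `u` (0 if `u` is not an end
of `e`; for a loop both ends contribute). -/
noncomputable def flowAt {V E P : Type} (inc : E → V × V) (w : CanValue E P)
    (e : E) (u : V) : ℝ :=
  (if (inc e).1 = u then w.f₁ else 0) + (if (inc e).2 = u then w.f₂ else 0)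

/-- The local condition of the canonical protocol at a vertex `u`:
if δ_e ∉ X^e for every edge `e` incident to `u`, then Σ_{e ∈ Inc(u)} f^e_u ≥ 0. -/
def CanLocal {V E P : Type} [Fintype E] (inc : E → V × V) (d : E → Form E P)
    (r : (e : E) → CanValue E P) (u : V) : Prop :=
  (∀ e : E, Incident inc e u → d e ∉ (r e).X) → 0 ≤ ∑ e : E, flowAt inc (r e) e u

/-- `r` is a run of the canonical protocol 𝒫^δ_F. -/
def IsCanRun {V E P : Type} [Fintype E] (inc : E → V × V) (edgeOf : P → E)
    (d : E → Form E P) (F : Set E) (r : (e : E) → CanValue E P) : Prop :=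
  (∀ e : E, IsCanValue inc edgeOf d F e (r e)) ∧ ∀ u : V, CanLocal inc d r u

/-- The set Γ_M of paths (Definition of Γ_M). -/
def InGamma {V E P : Type} [Fintype E] (inc : E → V × V) (d : E → Form E P)
    (M : Set (Form E P)) (p : GPath V E inc) : Prop :=
  0 < p.verts.length ∧
  (∀ h0 : 0 < p.verts.length,
    Form.box (p.edges.get ⟨0, by have := p.len_eq; omega⟩)
      (disjSet d (compEdges inc (p.edges.get ⟨0, by have := p.len_eq; omega⟩)
        (p.verts.get ⟨0, h0⟩))) ∈ M) ∧
  (∀ i (hi : i < p.verts.length),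
    d (p.edges.get ⟨i, by have := p.len_eq; omega⟩) ∉ M) ∧
  (∀ i (hi : i < p.verts.length),
    IsBridge inc (p.edges.get ⟨i, by have := p.len_eq; omega⟩) →
    Form.box (p.edges.get ⟨i, by have := p.len_eq; omega⟩)
      (disjSet d (compEdges inc (p.edges.get ⟨i, by have := p.len_eq; omega⟩)
        (p.verts.get ⟨i, hi⟩))) ∈ M) ∧
  (∀ hne : p.edges ≠ [], d (p.edges.getLast hne) ∈ M)

namespace Form

variable {V E P : Type} {inc : E → V × V} {edgeOf : P → E}

theorem evalWith_bigDisj (v : Form E P → Prop) (l : List (Form E P)) :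
    evalWith v (bigDisj l) ↔ ∃ φ ∈ l, evalWith v φ := by
  induction l with
  | nil => simp [bigDisj, evalWith]
  | cons φ l ih =>
    simp only [bigDisj, Form.or, neg, evalWith, ih, List.mem_cons, exists_eq_or_imp]
    tauto

theorem inLang_mono {A B : Set E} (h : A ⊆ B) {φ : Form E P} (hφ : InLang edgeOf A φ) :
    InLang edgeOf B φ := by
  induction hφ with
  | bot => exact .bot
  | atom p hp => exact .atom p (h hp)
  | imp _ _ ih₁ ih₂ => exact .imp ih₁ ih₂
  | box t φ ht => exact .box t φ (h ht)

theorem inLang_bigDisj {A : Set E} {l : List (Form E P)} (h : ∀ φ ∈ l, InLang edgeOf A φ) :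
    InLang edgeOf A (bigDisj l) := by
  induction l with
  | nil => exact .bot
  | cons φ l ih =>
    exact .imp (.imp (h φ (by simp)) .bot) (ih fun ψ hψ => h ψ (by simp [hψ]))

theorem deduction {X : Set (Form E P)} {φ ψ : Form E P}
    (h : DerivFrom inc edgeOf (insert φ X) ψ) : DerivFrom inc edgeOf X (imp φ ψ) := by
  have weaken : ∀ χ : Form E P, Deriv inc edgeOf (imp χ (imp φ χ)) := fun χ =>
    .taut fun v => by simp only [evalWith]; tauto
  induction h with
  | ax h => exact .ax ((weaken _).mp h)
  | @hyp χ h =>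
    rcases h with rfl | h
    · exact .ax (.taut fun v => by simp only [evalWith]; tauto)
    · exact .mp (.ax (weaken _)) (.hyp h)
  | @mp χ₁ χ₂ _ _ ih₁ ih₂ =>
    refine .mp (.mp (.ax (.taut (φ := imp (imp φ (imp χ₁ χ₂)) (imp (imp φ χ₁) (imp φ χ₂)))
      fun v => ?_)) ih₁) ih₂
    simp only [evalWith]; tauto

end Form

namespace MaxConsistent

open Form

variable {V E P : Type} {inc : E → V × V} {edgeOf : P → E} {M : Set (Form E P)}

theorem neg_derivable (hM : MaxConsistent inc edgeOf M) {φ : Form E P} (h : φ ∉ M) :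
    DerivFrom inc edgeOf M (neg φ) :=
  deduction (not_not.mp (hM.2 φ h))

theorem mem_of_derivFrom (hM : MaxConsistent inc edgeOf M) {φ : Form E P}
    (h : DerivFrom inc edgeOf M φ) : φ ∈ M := by
  by_contra hφ
  exact hM.1 (.mp (hM.neg_derivable hφ) h)

theorem mem_mp (hM : MaxConsistent inc edgeOf M) {φ ψ : Form E P}
    (h : Deriv inc edgeOf (imp φ ψ)) (hφ : φ ∈ M) : ψ ∈ M :=
  hM.mem_of_derivFrom (.mp (.ax h) (.hyp hφ))

theorem exists_mem_of_bigDisj_mem (hM : MaxConsistent inc edgeOf M) {l : List (Form E P)}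
    (h : bigDisj l ∈ M) : ∃ φ ∈ l, φ ∈ M := by
  induction l with
  | nil => exact absurd (.hyp h) hM.1
  | cons φ l ih =>
    by_cases hφ : φ ∈ M
    · exact ⟨φ, by simp, hφ⟩
    · obtain ⟨ψ, hψ, hψM⟩ := ih (hM.mem_of_derivFrom (.mp (.hyp h) (hM.neg_derivable hφ)))
      exact ⟨ψ, by simp [hψ], hψM⟩

theorem box_mono (hM : MaxConsistent inc edgeOf M) {e : E} {φ ψ : Form E P}
    (h : Deriv inc edgeOf (imp φ ψ)) (hφ : box e φ ∈ M) : box e ψ ∈ M :=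
  hM.mem_mp ((Deriv.distrib e φ ψ).mp (.nec e h)) hφ

theorem box_bigDisj_gateway (hM : MaxConsistent inc edgeOf M) {e g : E} {A B : Set E}
    {l l₁ l₂ : List (Form E P)} (hg : IsGateway inc A B g) (he : e ∈ A)
    (hl : ∀ φ ∈ l, φ ∈ l₁ ∨ φ ∈ l₂) (h₁ : ∀ φ ∈ l₁, InLang edgeOf A φ)
    (h₂ : ∀ φ ∈ l₂, InLang edgeOf B φ) (h : box e (bigDisj l) ∈ M) :
    box e (bigDisj (box g (bigDisj l₂) :: l₁)) ∈ M := by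
  have h' : box e (imp (neg (bigDisj l₁)) (bigDisj l₂)) ∈ M := by
    refine hM.box_mono (.taut fun v => ?_) h
    simp only [evalWith, neg, evalWith_bigDisj]
    rintro ⟨φ, hφ, hv⟩ hn
    rcases hl φ hφ with hφ | hφ
    · exact absurd ⟨φ, hφ, hv⟩ hn
    · exact ⟨φ, hφ, hv⟩
  have h'' := hM.box_mono (.gateway hg he (.imp (inLang_bigDisj h₁) .bot) (inLang_bigDisj h₂))
    (hM.mem_mp (.posIntro _ _) h')
  refine hM.box_mono (.taut fun v => ?_) h''
  simp only [bigDisj, Form.or, neg, evalWith]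
  tauto

/-- If an edge knows a disjunction over `S`, then parts of the disjunction lying behind gateways
may be replaced by what these gateways know. -/
theorem exists_of_box_disjSet [Fintype E] (hM : MaxConsistent inc edgeOf M) {d : E → Form E P}
    (hd : ∀ e : E, InLang edgeOf {e} (d e)) {e : E} {S : Set E} (T : List (E × Set E))
    (he : ∀ x ∈ T, e ∉ x.2) (hT : ∀ x ∈ T, ∀ y ∈ T, x.1 ∉ y.2)
    (hg : ∀ x ∈ T, IsGateway inc x.2ᶜ x.2 x.1) (h : box e (disjSet d S) ∈ M) :
    (∃ s ∈ S, (∀ x ∈ T, s ∉ x.2) ∧ d s ∈ M) ∨ ∃ x ∈ T, box x.1 (disjSet d x.2) ∈ M := by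
  have key : box e (bigDisj (T.map (fun x => box x.1 (disjSet d x.2)) ++
      (Set.toFinite {s ∈ S | ∀ x ∈ T, s ∉ x.2}).toFinset.toList.map d)) ∈ M := by
    induction T with
    | nil =>
      refine hM.box_mono (.taut fun v => ?_) h
      simp only [disjSet, disjOver, evalWith, evalWith_bigDisj]
      simp
    | cons x T ih =>
      have h' := ih (fun y hy => he y (by simp [hy]))
        (fun y hy z hz => hT y (by simp [hy]) z (by simp [hz]))
        (fun y hy => hg y (by simp [hy]))
      refine hM.box_bigDisj_gateway
        (l₁ := T.map (fun x => box x.1 (disjSet d x.2)) ++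
          (Set.toFinite {s ∈ S | ∀ y ∈ x :: T, s ∉ y.2}).toFinset.toList.map d)
        (l₂ := (Set.toFinite x.2).toFinset.toList.map d)
        (hg x (by simp)) (he x (by simp)) ?_ ?_ ?_ h'
      · intro φ hφ
        simp only [List.mem_append, List.mem_map, Finset.mem_toList, Set.Finite.mem_toFinset,
          Set.mem_ofPred_eq, List.mem_cons, forall_eq_or_imp] at hφ ⊢
        rcases hφ with hφ | ⟨s, ⟨hs, hsT⟩, rfl⟩
        · exact .inl (.inl hφ)
        · by_cases hsx : s ∈ x.2
          · exact .inr ⟨s, hsx, rfl⟩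
          · exact .inl (.inr ⟨s, ⟨hs, hsx, hsT⟩, rfl⟩)
      · intro φ hφ
        simp only [List.mem_append, List.mem_map, Finset.mem_toList, Set.Finite.mem_toFinset,
          Set.mem_ofPred_eq, List.mem_cons, forall_eq_or_imp] at hφ
        rcases hφ with ⟨y, hy, rfl⟩ | ⟨s, ⟨_, hsx, _⟩, rfl⟩
        · exact .box _ _ (hT y (by simp [hy]) x (by simp))
        · exact inLang_mono (by simpa using hsx) (hd s)
      · intro φ hφ
        simp only [List.mem_map, Finset.mem_toList, Set.Finite.mem_toFinset] at hφ
        obtain ⟨s, hs, rfl⟩ := hφ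
        exact inLang_mono (by simpa using hs) (hd s)
  obtain ⟨φ, hφ, hφM⟩ := hM.exists_mem_of_bigDisj_mem (hM.mem_mp (.truth _ _) key)
  simp only [List.mem_append, List.mem_map, Finset.mem_toList, Set.Finite.mem_toFinset,
    Set.mem_ofPred_eq] at hφ
  rcases hφ with ⟨x, hx, rfl⟩ | ⟨s, ⟨hs, hsT⟩, rfl⟩
  · exact .inr ⟨x, hx, hφM⟩
  · exact .inl ⟨s, hs, hsT, hφM⟩

end MaxConsistent

section Multigraph

variable {V E : Type} {inc : E → V × V}

theorem AdjVia.symm {S : Set E} {u v : V} (h : AdjVia inc S u v) : AdjVia inc S v u := by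
  obtain ⟨e, he, h⟩ := h
  exact ⟨e, he, h.symm⟩

theorem ReachableVia.symm {S : Set E} {u v : V} (h : ReachableVia inc S u v) :
    ReachableVia inc S v u := by
  induction h with
  | refl => exact .refl
  | tail _ h ih => exact ih.head h.symm

theorem reachableVia_of_incident {S : Set E} {e : E} (he : e ∈ S) {u v : V}
    (hu : Incident inc e u) (hv : Incident inc e v) : ReachableVia inc S u v := by
  rcases hu with rfl | rfl <;> rcases hv with rfl | rfl
  · exact .refl
  · exact .single ⟨e, he, .inl rfl⟩
  · exact .single ⟨e, he, .inr rfl⟩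
  · exact .refl

theorem reachableVia_of_mem_compEdges {e f : E} {u v : V} (hf : f ∈ compEdges inc e u)
    (hv : Incident inc f v) : ReachableVia inc {x | x ≠ e} u v := by
  obtain ⟨hfe, w, hw, hr⟩ := hf
  exact hr.trans (reachableVia_of_incident hfe hw hv)

theorem isGateway_compEdges (e : E) (u : V) :
    IsGateway inc (compEdges inc e u)ᶜ (compEdges inc e u) e := by
  intro p hne hA hB
  by_contra he
  have key : ∀ i (hi : i < p.edges.length), p.edges[i] ∉ compEdges inc e u := by
    intro i
    induction i with
    | zero => intro hi; simpa [List.head_eq_getElem] using hA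
    | succ i ih =>
      intro hi hmem
      have hi' : i < p.verts.length := by have := p.len_eq; omega
      have h₁ := p.incid_left i hi'
      have h₂ := p.incid_right i hi'
      simp only [List.get_eq_getElem] at h₁ h₂
      exact ih (by omega) ⟨fun h => he (h ▸ List.getElem_mem _), _, h₁,
        reachableVia_of_mem_compEdges hmem h₂⟩
  exact key _ _ (List.getLast_eq_getElem hne ▸ hB)

theorem not_reachableVia_of_isBridge (hconn : ConnectedGraph inc) {b : E} (hb : IsBridge inc b)
    {u w : V} (hbe : inc b = (u, w) ∨ inc b = (w, u)) : ¬ ReachableVia inc {x | x ≠ b} w u := by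
  intro h
  refine hb fun x y => ?_
  induction hconn x y with
  | refl => exact .refl
  | @tail y z _ hyz ih =>
    refine ih.trans ?_
    obtain ⟨f, -, hf⟩ := hyz
    by_cases hfb : f = b
    · subst hfb
      rcases hbe with hbe | hbe <;> rw [hbe] at hf <;> simp only [Prod.mk.injEq] at hf <;>
        rcases hf with ⟨rfl, rfl⟩ | ⟨rfl, rfl⟩ <;> first | exact h | exact h.symm
    · exact .single ⟨f, hfb, hf⟩

theorem eq_or_mem_compEdges (hconn : ConnectedGraph inc) (e f : E) :
    f = e ∨ f ∈ compEdges inc e (inc e).1 ∨ f ∈ compEdges inc e (inc e).2 := by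
  have key : ∀ v, ReachableVia inc {x | x ≠ e} (inc e).1 v ∨
      ReachableVia inc {x | x ≠ e} (inc e).2 v := by
    intro v
    induction hconn (inc e).1 v with
    | refl => exact .inl .refl
    | @tail y z _ hyz ih =>
      obtain ⟨g, -, hg⟩ := hyz
      by_cases hge : g = e
      · subst hge
        rcases hg with hg | hg <;> rw [hg]
        · exact .inr .refl
        · exact .inl .refl
      · exact ih.imp (·.tail ⟨g, hge, hg⟩) (·.tail ⟨g, hge, hg⟩)
  by_cases hfe : f = e
  · exact .inl hfe
  · exact .inr ((key (inc f).1).imp (fun h => ⟨hfe, _, .inl rfl, h⟩)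
      (fun h => ⟨hfe, _, .inl rfl, h⟩))

end Multigraph

section Gamma

variable {V E P : Type} [Fintype E]

/-- The edge `x ≠ e` may be traversed from `u` to `w` by a path of `Γ_M` starting with `e`. -/
structure GammaStep (inc : E → V × V) (d : E → Form E P) (M : Set (Form E P)) (e x : E)
    (u w : V) : Prop where
  ne : x ≠ e
  ends : inc x = (u, w) ∨ inc x = (w, u)
  notMem : d x ∉ M
  box_mem : IsBridge inc x → Form.box x (disjSet d (compEdges inc x w)) ∈ M

/-- The tails `v₁, e₁, …, v_k, e_k` of paths of `Γ_M` starting with `e`. -/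
inductive GammaTail (inc : E → V × V) (d : E → Form E P) (M : Set (Form E P)) (e : E) :
    V → List E → List V → Prop
  | last {v : V} {x : E} : Incident inc x v → d x ∈ M → GammaTail inc d M e v [x] [v]
  | cons {v w : V} {x : E} {es : List E} {vs : List V} : GammaStep inc d M e x v w →
      GammaTail inc d M e w es vs → v ∉ vs → GammaTail inc d M e v (x :: es) (v :: vs)

variable {inc : E → V × V} {d : E → Form E P} {M : Set (Form E P)} {e : E}

theorem GammaStep.incident_left {x : E} {u w : V} (h : GammaStep inc d M e x u w) :
    Incident inc x u := by
  rcases h.ends with h | h <;> simp [Incident, h]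

theorem GammaStep.incident_right {x : E} {u w : V} (h : GammaStep inc d M e x u w) :
    Incident inc x w := by
  rcases h.ends with h | h <;> simp [Incident, h]

namespace GammaTail

variable {v : V} {es : List E} {vs : List V}

theorem exists_of_mem (h : GammaTail inc d M e v es vs) {u : V} (hu : u ∈ vs) :
    ∃ es' vs', GammaTail inc d M e u es' vs' := by
  induction h with
  | last hx hd =>
    obtain rfl := List.mem_singleton.mp hu
    exact ⟨_, _, .last hx hd⟩
  | cons hs ht hv ih =>
    rcases List.mem_cons.mp hu with rfl | hu
    · exact ⟨_, _, .cons hs ht hv⟩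
    · exact ih hu

theorem exists_of_reachable {u w : V}
    (hr : Relation.ReflTransGen (fun u w => ∃ x, GammaStep inc d M e x u w) u w) {x : E}
    (hx : Incident inc x w) (hdx : d x ∈ M) : ∃ es vs, GammaTail inc d M e u es vs := by
  induction hr using Relation.ReflTransGen.head_induction_on with
  | refl => exact ⟨_, _, .last hx hdx⟩
  | @head a b hab _ ih =>
    obtain ⟨es, vs, ht⟩ := ih
    obtain ⟨y, hy⟩ := hab
    by_cases ha : a ∈ vs
    · exact ht.exists_of_mem ha
    · exact ⟨_, _, .cons hy ht ha⟩

theorem length_eq (h : GammaTail inc d M e v es vs) : es.length = vs.length := by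
  induction h with
  | last => rfl
  | cons _ _ _ ih => simp [ih]

theorem verts_pos (h : GammaTail inc d M e v es vs) : 0 < vs.length := by
  cases h <;> simp

theorem getElem_zero (h : GammaTail inc d M e v es vs) : vs[0]'h.verts_pos = v := by
  cases h <;> rfl

theorem verts_nodup (h : GammaTail inc d M e v es vs) : vs.Nodup := by
  induction h with
  | last => simp
  | cons _ _ hv ih => exact List.nodup_cons.mpr ⟨hv, ih⟩

theorem start_mem (h : GammaTail inc d M e v es vs) : v ∈ vs := by
  cases h <;> simp

theorem mem_or_incident (h : GammaTail inc d M e v es vs) :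
    ∀ y ∈ es, d y ∈ M ∨ (y ≠ e ∧ ∀ z, Incident inc y z → z ∈ vs) := by
  induction h with
  | last _ hd => intro y hy; rw [List.mem_singleton.mp hy]; exact .inl hd
  | cons hs ht _ ih =>
    intro y hy
    rcases List.mem_cons.mp hy with rfl | hy
    · refine .inr ⟨hs.ne, fun z hz => ?_⟩
      have := ht.start_mem
      rcases hs.ends with h | h <;> simp only [Incident, h] at hz <;>
        rcases hz with rfl | rfl <;> simp [this]
    · exact (ih y hy).imp_right fun h => ⟨h.1, fun z hz => List.mem_cons_of_mem _ (h.2 z hz)⟩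

theorem notMem_edges (h : GammaTail inc d M e v es vs) (hde : d e ∉ M) : e ∉ es := fun he =>
  (h.mem_or_incident e he).elim hde fun h => h.1 rfl

theorem edges_nodup (h : GammaTail inc d M e v es vs) : es.Nodup := by
  induction h with
  | last => simp
  | cons hs ht hv ih =>
    refine List.nodup_cons.mpr ⟨fun hx => ?_, ih⟩
    exact (ht.mem_or_incident _ hx).elim hs.notMem fun h => hv (h.2 _ hs.incident_left)

theorem getLast_mem (h : GammaTail inc d M e v es vs) (hne : es ≠ []) : d (es.getLast hne) ∈ M := by
  induction h with
  | last _ hd => exact hd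
  | cons _ ht _ ih =>
    have := List.ne_nil_of_length_pos (ht.length_eq ▸ ht.verts_pos)
    rw [List.getLast_cons this]
    exact ih this

theorem incident (h : GammaTail inc d M e v es vs) (i : ℕ) (hi : i < vs.length) :
    Incident inc (es[i]'(h.length_eq ▸ hi)) vs[i] := by
  induction h generalizing i with
  | last hx _ =>
    obtain rfl : i = 0 := by simpa using hi
    exact hx
  | cons hs _ _ ih =>
    cases i with
    | zero => exact hs.incident_left
    | succ i => exact ih i (by simpa using hi)

theorem step (h : GammaTail inc d M e v es vs) (i : ℕ) (hi : i + 1 < vs.length) :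
    GammaStep inc d M e (es[i]'(by have := h.length_eq; omega)) vs[i] vs[i + 1] := by
  induction h generalizing i with
  | last hx _ => simp at hi
  | @cons v w x es vs hs ht _ ih =>
    cases i with
    | zero =>
      have := ht.getElem_zero
      simpa [this] using hs
    | succ i => exact ih i (by simpa using hi)

/-- The path of `Γ_M` obtained by putting `e` in front of a tail. -/
def toPath (h : GammaTail inc d M e v es vs) (hev : Incident inc e v) (hde : d e ∉ M) :
    GPath V E inc where
  edges := e :: es
  verts := vs
  len_eq := by simp [h.length_eq]
  edges_nodup := List.nodup_cons.mpr ⟨h.notMem_edges hde, h.edges_nodup⟩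
  verts_nodup := h.verts_nodup
  incid_left i hi := by
    cases i with
    | zero => simpa [h.getElem_zero] using hev
    | succ i => exact (h.step i hi).incident_right
  incid_right i hi := h.incident i hi

theorem inGamma_toPath (h : GammaTail inc d M e v es vs) (hev : Incident inc e v) (hde : d e ∉ M)
    (hbox : Form.box e (disjSet d (compEdges inc e v)) ∈ M) :
    InGamma inc d M (h.toPath hev hde) := by
  refine ⟨h.verts_pos, fun _ => ?_, fun i hi => ?_, fun i hi hb => ?_, fun _ => ?_⟩
  · simpa [toPath, h.getElem_zero] using hbox
  · cases i with
    | zero => exact hde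
    | succ i => exact (h.step i hi).notMem
  · cases i with
    | zero => simpa [toPath, h.getElem_zero] using hbox
    | succ i => exact (h.step i hi).box_mem hb
  · have := List.ne_nil_of_length_pos (h.length_eq ▸ h.verts_pos)
    simpa [toPath, List.getLast_cons this] using h.getLast_mem this

end GammaTail

theorem exists_gammaStep_reachable (hconn : ConnectedGraph inc) {edgeOf : P → E}
    (hd : ∀ e : E, InLang edgeOf {e} (d e)) (hM : MaxConsistent inc edgeOf M) {v : V}
    (hev : Incident inc e v) (hbox : Form.box e (disjSet d (compEdges inc e v)) ∈ M) :
    ∃ w x, Relation.ReflTransGen (fun u w => ∃ x, GammaStep inc d M e x u w) v w ∧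
      Incident inc x w ∧ d x ∈ M := by
  by_contra! hcon
  let W : Set V :=
    {w | Relation.ReflTransGen (fun u w => ∃ x, GammaStep inc d M e x u w) v w}
  -- The bridges leaving the set `W` of reachable vertices.
  let Exit : E → V → Prop := fun b w => b ≠ e ∧ IsBridge inc b ∧ w ∉ W ∧
    ∃ u ∈ W, inc b = (u, w) ∨ inc b = (w, u)
  have hreach : ∀ {b w}, Exit b w → ∀ u ∈ W, ReachableVia inc {x | x ≠ b} v u := by
    rintro b w ⟨-, -, hwW, _, -, hb⟩ u hu
    have hbw : Incident inc b w := by rcases hb with hb | hb <;> simp [Incident, hb]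
    induction hu with
    | refl => exact .refl
    | @tail y z hy hyz ih =>
      obtain ⟨x, hx⟩ := hyz
      have hz : z ∈ W := hy.tail ⟨x, hx⟩
      refine ih.tail ⟨x, ?_, hx.ends⟩
      rintro rfl
      rcases hx.ends with h | h <;> simp only [Incident, h] at hbw <;>
        rcases hbw with rfl | rfl <;> first | exact hwW hy | exact hwW hz
  have hsep : ∀ {b w}, Exit b w → ∀ u ∈ W, ¬ ReachableVia inc {x | x ≠ b} w u := by
    intro b w hbw u hu hr
    obtain ⟨-, hb, -, u', hu', hbe⟩ := id hbw
    exact not_reachableVia_of_isBridge hconn hb hbe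
      (hr.trans ((hreach hbw u hu).symm.trans (hreach hbw u' hu')))
  have hsep' : ∀ {b w}, Exit b w → ∀ u ∈ W, ∀ f, Incident inc f u → f ∉ compEdges inc b w :=
    fun hbw u hu f hf hmem => hsep hbw u hu (reachableVia_of_mem_compEdges hmem hf)
  have hvW : v ∈ W := .refl
  let T : Set (E × Set E) := {x | ∃ b w, Exit b w ∧ x = (b, compEdges inc b w)}
  have hTfin : T.Finite := Set.toFinite T
  rcases hM.exists_of_box_disjSet hd hTfin.toFinset.toList
    (by
      simp only [Finset.mem_toList, Set.Finite.mem_toFinset]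
      rintro _ ⟨b, w, hbw, rfl⟩
      exact hsep' hbw v hvW e hev)
    (by
      simp only [Finset.mem_toList, Set.Finite.mem_toFinset]
      rintro _ ⟨b, w, ⟨-, -, -, u, hu, hbe⟩, rfl⟩ _ ⟨b', w', hbw', rfl⟩
      exact hsep' hbw' u hu b (by rcases hbe with h | h <;> simp [Incident, h]))
    (by
      simp only [Finset.mem_toList, Set.Finite.mem_toFinset]
      rintro _ ⟨b, w, -, rfl⟩
      exact isGateway_compEdges b w) hbox with ⟨s, ⟨hse, y, hy, hr⟩, hsT, hsM⟩ | ⟨x, hxT, hxM⟩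
  · have key : y ∈ W ∨ ∃ b w, Exit b w ∧ ReachableVia inc {x | x ≠ b} w y := by
      clear hy
      induction hr with
      | refl => exact .inl hvW
      | @tail y z _ hyz ih =>
        obtain ⟨f, hfe, hf⟩ := hyz
        rcases ih with hy | ⟨b, w, hbw, hr⟩
        · by_cases hz : z ∈ W
          · exact .inl hz
          · refine .inr ⟨f, z, ⟨hfe, ?_, hz, y, hy, hf⟩, .refl⟩
            by_contra hb
            refine hz (Relation.ReflTransGen.tail hy ⟨f, hfe, hf, ?_, fun h => absurd h hb⟩)
            exact hcon y f hy (by rcases hf with h | h <;> simp [Incident, h])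
        · by_cases hfb : f = b
          · subst hfb
            obtain ⟨-, -, -, u, hu, hbe⟩ := id hbw
            have hyu : y ≠ u := by rintro rfl; exact hsep hbw y hu hr
            rcases hbe with hbe | hbe <;> rw [hbe] at hf <;> simp only [Prod.mk.injEq] at hf <;>
              grind
          · exact .inr ⟨b, w, hbw, hr.tail ⟨f, hfb, hf⟩⟩
    rcases key with hyW | ⟨b, w, hbw, hr⟩
    · exact hcon y s hyW hy hsM
    · by_cases hsb : s = b
      · obtain ⟨-, -, -, u, hu, hbe⟩ := hbw
        exact hcon u s hu (by subst hsb; rcases hbe with h | h <;> simp [Incident, h]) hsM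
      · exact hsT (b, compEdges inc b w) (by simpa using ⟨b, w, hbw, rfl⟩) ⟨hsb, y, hy, hr⟩
  · simp only [Finset.mem_toList, Set.Finite.mem_toFinset] at hxT
    obtain ⟨b, w, ⟨hbe, -, hwW, u, hu, hb⟩, rfl⟩ := hxT
    refine hwW (Relation.ReflTransGen.tail hu ⟨b, hbe, hb, ?_, fun _ => hxM⟩)
    exact hcon u b hu (by rcases hb with h | h <;> simp [Incident, h])

end Gamma

/-- Path-existence lemma: for any δ = ⋁_{e∈E} δ_e ∈ Δ(Σ), any
maximal consistent set M ⊆ Φ(Σ), and any edge e, if □_eδ ∈ M and δ_e ∉ M, then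
there is a path in Γ_M that starts with the edge e. -/
theorem path_exists {V E P : Type} [Fintype E] (inc : E → V × V) (edgeOf : P → E)
    (hconn : ConnectedGraph inc)
    (d : E → Form E P) (hd : ∀ e : E, InLang edgeOf {e} (d e))
    (M : Set (Form E P)) (hM : MaxConsistent inc edgeOf M)
    (e : E) (hbox : Form.box e (deltaForm d) ∈ M) (hde : d e ∉ M) :
    ∃ p : GPath V E inc, InGamma inc d M p ∧ p.edges.head? = some e := by
  have hend : ∃ v, Incident inc e v ∧ Form.box e (disjSet d (compEdges inc e v)) ∈ M := by
    have hbox' : Form.box e (disjSet d Set.univ) ∈ M := by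
      simpa [disjSet, deltaForm] using hbox
    rcases hM.exists_of_box_disjSet hd
      [(e, compEdges inc e (inc e).1), (e, compEdges inc e (inc e).2)]
      (by simp [compEdges]) (by simp [compEdges]) (by simp [isGateway_compEdges]) hbox' with
      ⟨s, -, hs, hsM⟩ | h
    · simp only [List.mem_cons, List.not_mem_nil, or_false, forall_eq_or_imp, forall_eq] at hs
      rcases eq_or_mem_compEdges hconn e s with rfl | h | h
      · exact absurd hsM hde
      · exact absurd h hs.1
      · exact absurd h hs.2
    · simp only [List.mem_cons, List.not_mem_nil, or_false, exists_eq_or_imp, exists_eq_left] at h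
      exact h.elim (fun h => ⟨_, .inl rfl, h⟩) (fun h => ⟨_, .inr rfl, h⟩)
  obtain ⟨v, hev, hboxv⟩ := hend
  obtain ⟨w, x, hr, hx, hxM⟩ := exists_gammaStep_reachable hconn hd hM hev hboxv
  obtain ⟨es, vs, ht⟩ := GammaTail.exists_of_reachable hr hx hxM
  exact ⟨ht.toPath hev hde, ht.inGamma_toPath hev hde hboxv, rfl⟩
end
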